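/- Let F be a field, n a natural number, and (V_i, L) a Lefschetz system over F. Then for every 0 ≤ i ≤ 2n, each α ∈ V_i admits a unique representation α = Σ_j L^j(α_j), where j ranges over max(i−n, 0) ≤ j ≤ ⌊i/2⌋ and each α_j lies in the primitive subspace P_{i−2j}. (Primitive, or Lefschetz, decomposition.) -/

import Mathlib

/-- `a : ℕ → W` is a primitive decomposition of `α ∈ V i`: each component `a j`
(for `max(i-n,0) ≤ j ≤ ⌊i/2⌋`) lies in the primitive subspace
`P (i-2j) = V (i-2j) ⊓ ker (L^(n-(i-2j)+1))`, the components outside this range vanish,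
and `α = ∑ j, L^j (a j)`. -/
def IsPrimDecomp {F W : Type*} [Field F] [AddCommGroup W] [Module F W]
    (n i : ℕ) (V : ℕ → Submodule F W) (L : W →ₗ[F] W) (α : W) (a : ℕ → W) : Prop :=
  (∀ j ∈ Finset.Icc (i - n) (i / 2),
      a j ∈ V (i - 2 * j) ∧ (L ^ (n - (i - 2 * j) + 1)) (a j) = 0) ∧
  (∀ j ∉ Finset.Icc (i - n) (i / 2), a j = 0) ∧
  α = ∑ j ∈ Finset.Icc (i - n) (i / 2), (L ^ j) (a j)

section PrimitiveDecomposition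

variable {F W : Type*} [Field F] [AddCommGroup W] [Module F W]
  {n : ℕ} {V : ℕ → Submodule F W} {L : W →ₗ[F] W}

theorem pow_apply_mem_of_map_le (hL : ∀ i, Submodule.map L (V i) ≤ V (i + 2))
    (k i : ℕ) {x : W} (hx : x ∈ V i) : (L ^ k) x ∈ V (i + 2 * k) := by
  induction k with
  | zero => simpa using hx
  | succ k ih =>
    rw [pow_succ', Module.End.mul_apply]
    exact hL _ (Submodule.mem_map_of_mem ih)

theorem sum_pow_apply_mem (hL : ∀ i, Submodule.map L (V i) ≤ V (i + 2)) (i : ℕ) {a : ℕ → W}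
    (ha : ∀ j ≤ i / 2, a j ∈ V (i - 2 * j)) :
    ∑ j ∈ Finset.range (i / 2 + 1), (L ^ j) (a j) ∈ V i := by
  refine Submodule.sum_mem _ fun j hj => ?_
  have hj' : j ≤ i / 2 := Nat.lt_succ_iff.mp (Finset.mem_range.mp hj)
  have h := pow_apply_mem_of_map_le hL j (i - 2 * j) (ha j hj')
  rwa [show i - 2 * j + 2 * j = i by omega] at h

/-- Existence of the primitive decomposition up to the middle degree. -/
theorem exists_prim_decomp_of_le (hL : ∀ i, Submodule.map L (V i) ≤ V (i + 2))
    (htriv : ∀ i, 2 * n < i → V i = ⊥)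
    (hsurj : ∀ i ≤ n, Submodule.map (L ^ (n - i)) (V i) = V (2 * n - i)) :
    ∀ i ≤ n, ∀ α ∈ V i, ∃ a : ℕ → W,
      (∀ j ≤ i / 2, a j ∈ V (i - 2 * j) ∧ (L ^ (n - (i - 2 * j) + 1)) (a j) = 0) ∧
      α = ∑ j ∈ Finset.range (i / 2 + 1), (L ^ j) (a j) := by
  intro i
  induction i using Nat.twoStepInduction with
  | zero =>
    intro _ α hα
    refine ⟨fun _ => α, fun j hj => ?_, by simp⟩
    obtain rfl : j = 0 := by omega
    refine ⟨hα, ?_⟩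
    have h := pow_apply_mem_of_map_le hL (n + 1) 0 hα
    rwa [htriv _ (by omega), Submodule.mem_bot] at h
  | one =>
    intro _ α hα
    refine ⟨fun _ => α, fun j hj => ?_, by simp⟩
    obtain rfl : j = 0 := by omega
    refine ⟨hα, ?_⟩
    have h := pow_apply_mem_of_map_le hL (n - 1 + 1) 1 hα
    rwa [htriv _ (by omega), Submodule.mem_bot] at h
  | more i ih _ =>
    intro hi α hα
    have h := pow_apply_mem_of_map_le hL (n - (i + 2) + 1) (i + 2) hα
    rw [show i + 2 + 2 * (n - (i + 2) + 1) = 2 * n - i by omega, ← hsurj i (by omega)] at h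
    obtain ⟨β, hβ, hβα⟩ := h
    obtain ⟨b, hb, hsum⟩ := ih (by omega) β hβ
    refine ⟨fun j => Nat.casesOn j (α - L β) b, fun j hj => ?_, ?_⟩
    · cases j with
      | zero =>
        refine ⟨Submodule.sub_mem _ hα (hL i (Submodule.mem_map_of_mem hβ)), ?_⟩
        change (L ^ (n - (i + 2) + 1)) (α - L β) = 0
        rw [map_sub, ← hβα, ← Module.End.mul_apply, ← pow_succ,
          show n - (i + 2) + 1 + 1 = n - i by omega, sub_self]
      | succ j =>
        have h := hb j (by omega)
        rwa [show i - 2 * j = i + 2 - 2 * (j + 1) by omega] at h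
    · rw [show (i + 2) / 2 = i / 2 + 1 by omega, Finset.sum_range_succ']
      simp only [pow_succ', Module.End.mul_apply, pow_zero, Module.End.one_apply]
      rw [← map_sum, ← hsum]
      exact (add_sub_cancel (L β) α).symm

/-- Primitive components summing to zero vanish, up to the middle degree. -/
theorem prim_components_eq_zero_of_sum_eq_zero
    (hL : ∀ i, Submodule.map L (V i) ≤ V (i + 2))
    (hinj : ∀ i ≤ n, ∀ x ∈ V i, (L ^ (n - i)) x = 0 → x = 0) :
    ∀ i ≤ n, ∀ a : ℕ → W,
      (∀ j ≤ i / 2, a j ∈ V (i - 2 * j) ∧ (L ^ (n - (i - 2 * j) + 1)) (a j) = 0) →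
      ∑ j ∈ Finset.range (i / 2 + 1), (L ^ j) (a j) = 0 → ∀ j ≤ i / 2, a j = 0 := by
  intro i
  induction i using Nat.twoStepInduction with
  | zero =>
    intro _ a _ hsum j hj
    obtain rfl : j = 0 := by omega
    simpa using hsum
  | one =>
    intro _ a _ hsum j hj
    obtain rfl : j = 0 := by omega
    simpa using hsum
  | more i ih _ =>
    intro hi a ha hsum
    have hb : ∀ j ≤ i / 2, a (j + 1) ∈ V (i - 2 * j) ∧
        (L ^ (n - (i - 2 * j) + 1)) (a (j + 1)) = 0 := fun j hj => by
      have h := ha (j + 1) (by omega)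
      rwa [show i + 2 - 2 * (j + 1) = i - 2 * j by omega] at h
    rw [show (i + 2) / 2 = i / 2 + 1 by omega, Finset.sum_range_succ'] at hsum
    simp only [pow_succ', Module.End.mul_apply, pow_zero, Module.End.one_apply] at hsum
    rw [← map_sum] at hsum
    have htail : ∑ j ∈ Finset.range (i / 2 + 1), (L ^ j) (a (j + 1)) = 0 := by
      refine hinj i (by omega) _ (sum_pow_apply_mem hL i fun j hj => (hb j hj).1) ?_
      have h0 : (L ^ (n - (i + 2) + 1)) (a 0) = 0 := (ha 0 (by omega)).2
      have h := congrArg (L ^ (n - (i + 2) + 1)) hsum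
      rwa [map_add, h0, add_zero, map_zero, ← Module.End.mul_apply, ← pow_succ,
        show n - (i + 2) + 1 + 1 = n - i by omega] at h
    rw [htail, map_zero, zero_add] at hsum
    intro j hj
    cases j with
    | zero => exact hsum
    | succ j => exact ih (by omega) _ hb htail j (by omega)

theorem sum_Icc_pow_apply_eq {i : ℕ} (hi : i ≤ 2 * n) (L : W →ₗ[F] W) (a : ℕ → W) :
    ∑ j ∈ Finset.Icc (i - n) (i / 2), (L ^ j) (a j) =
      (L ^ (i - n)) (∑ j ∈ Finset.range ((i - 2 * (i - n)) / 2 + 1),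
        (L ^ j) (a (i - n + j))) := by
  have hIcc : Finset.Icc (i - n) (i / 2) = Finset.Ico (i - n) (i / 2 + 1) := by
    ext j
    simp only [Finset.mem_Icc, Finset.mem_Ico]
    omega
  rw [hIcc, Finset.sum_Ico_eq_sum_range, map_sum,
    show i / 2 + 1 - (i - n) = (i - 2 * (i - n)) / 2 + 1 by omega]
  simp only [pow_add, Module.End.mul_apply]

end PrimitiveDecomposition

/-- primitive/Lefschetz decomposition.
For a Lefschetz system `(V, L)` over `F` (encoded inside an ambient space `W`),
every `α ∈ V i` with `0 ≤ i ≤ 2n` admits a unique primitive decomposition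
`α = ∑_{max(i-n,0) ≤ j ≤ ⌊i/2⌋} L^j (α_j)` with `α_j ∈ P (i - 2j)`. -/
theorem statement1
    {F W : Type*} [Field F] [AddCommGroup W] [Module F W]
    (n : ℕ) (V : ℕ → Submodule F W) [∀ i, FiniteDimensional F (V i)]
    (L : W →ₗ[F] W)
    (hL : ∀ i, Submodule.map L (V i) ≤ V (i + 2))
    (htriv : ∀ i, 2 * n < i → V i = ⊥)
    (hHL : ∀ i ≤ n, (∀ x ∈ V i, (L ^ (n - i)) x = 0 → x = 0) ∧
      Submodule.map (L ^ (n - i)) (V i) = V (2 * n - i)) :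
    ∀ i ≤ 2 * n, ∀ α ∈ V i, ∃! a : ℕ → W, IsPrimDecomp n i V L α a := by
  intro i hi α hα
  have hinj : ∀ i ≤ n, ∀ x ∈ V i, (L ^ (n - i)) x = 0 → x = 0 := fun i hi => (hHL i hi).1
  have hm : i - 2 * (i - n) ≤ n := by omega
  refine existsUnique_of_exists_of_unique ?_ ?_
  · obtain ⟨β, hβ, rfl⟩ : ∃ β ∈ V (i - 2 * (i - n)), (L ^ (i - n)) β = α := by
      rcases le_total i n with h | h
      · rw [Nat.sub_eq_zero_of_le h]
        exact ⟨α, hα, rfl⟩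
      · have hs := (hHL _ hm).2
        rw [show n - (i - 2 * (i - n)) = i - n by omega,
          show 2 * n - (i - 2 * (i - n)) = i by omega] at hs
        rwa [← hs] at hα
    obtain ⟨b, hb, hsum⟩ :=
      exists_prim_decomp_of_le hL htriv (fun i hi => (hHL i hi).2) _ hm β hβ
    refine ⟨fun j => if j ∈ Finset.Icc (i - n) (i / 2) then b (j - (i - n)) else 0,
      fun j hj => ?_, fun j hj => if_neg hj, ?_⟩
    · simp only [if_pos hj]
      rw [Finset.mem_Icc] at hj
      have h := hb (j - (i - n)) (by omega)
      rwa [show i - 2 * (i - n) - 2 * (j - (i - n)) = i - 2 * j by omega] at h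
    · rw [sum_Icc_pow_apply_eq hi, hsum]
      refine congrArg _ (Finset.sum_congr rfl fun j hj => ?_)
      rw [Finset.mem_range] at hj
      rw [if_pos (Finset.mem_Icc.mpr ⟨by omega, by omega⟩), Nat.add_sub_cancel_left]
  · rintro a b ⟨ha, ha0, hasum⟩ ⟨hb, hb0, hbsum⟩
    have hc : ∀ j ≤ (i - 2 * (i - n)) / 2,
        a (i - n + j) - b (i - n + j) ∈ V (i - 2 * (i - n) - 2 * j) ∧
        (L ^ (n - (i - 2 * (i - n) - 2 * j) + 1)) (a (i - n + j) - b (i - n + j)) = 0 := by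
      intro j hj
      have hmem : i - n + j ∈ Finset.Icc (i - n) (i / 2) :=
        Finset.mem_Icc.mpr ⟨by omega, by omega⟩
      rw [show i - 2 * (i - n) - 2 * j = i - 2 * (i - n + j) by omega]
      exact ⟨Submodule.sub_mem _ (ha _ hmem).1 (hb _ hmem).1,
        by rw [map_sub, (ha _ hmem).2, (hb _ hmem).2, sub_zero]⟩
    have hmap : (L ^ (i - n)) (∑ j ∈ Finset.range ((i - 2 * (i - n)) / 2 + 1),
        (L ^ j) (a (i - n + j) - b (i - n + j))) = 0 := by
      rw [← sum_Icc_pow_apply_eq hi L fun j => a j - b j]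
      simp only [map_sub, Finset.sum_sub_distrib]
      rw [← hasum, ← hbsum, sub_self]
    have hsum : ∑ j ∈ Finset.range ((i - 2 * (i - n)) / 2 + 1),
        (L ^ j) (a (i - n + j) - b (i - n + j)) = 0 := by
      rcases le_total i n with h | h
      · rwa [Nat.sub_eq_zero_of_le h] at hmap ⊢
      · refine hinj _ hm _ (sum_pow_apply_mem hL _ fun j hj => (hc j hj).1) ?_
        rwa [show n - (i - 2 * (i - n)) = i - n by omega]
    have hzero := prim_components_eq_zero_of_sum_eq_zero hL hinj _ hm _ hc hsum
    funext j
    by_cases hj : j ∈ Finset.Icc (i - n) (i / 2)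
    · rw [Finset.mem_Icc] at hj
      have h := hzero (j - (i - n)) (by omega)
      rw [Nat.add_sub_cancel' hj.1] at h
      exact sub_eq_zero.mp h
    · rw [ha0 j hj, hb0 j hj]
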